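/- Let H = (h_{j,k})_{j,k≥1} be the Hilbert matrix, h_{j,k} = 1/(j+k−1), and let 1 ≤ p < ∞. Then the ℓ_p-norm of H is determined by decreasing sequences: for every nonnegative sequence x with ∑_{k=1}^∞ x_k^p < ∞ there exists a nonnegative antitone sequence y with ∑_{k=1}^∞ y_k^p = ∑_{k=1}^∞ x_k^p and ∑_{j=1}^∞ ((Hy)_j)^p ≥ ∑_{j=1}^∞ ((Hx)_j)^p. -/

import Mathlib

open scoped ENNReal

/-- `(Ax)_j = ∑_k a_{j,k} x_k`, taken in `[0,∞]`.  Rows and columns are indexed by `ℕ`,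
with index `i` corresponding to the paper's index `i+1`. -/
noncomputable def mulVec (A : ℕ → ℕ → ℝ) (x : ℕ → ℝ) (j : ℕ) : ℝ≥0∞ :=
  ∑' k, ENNReal.ofReal (A j k * x k)

/-- The Hilbert matrix `h_{j,k} = 1/(j+k-1)` (paper's 1-based indexing); with 0-based
indices the entry is `1/(j+k+1)`. -/
noncomputable def hilbertMatrix : ℕ → ℕ → ℝ := fun j k => 1 / ((j : ℝ) + (k : ℝ) + 1)

/-- The decreasing rearrangement of a sequence: `y n` is the least `t ≥ 0` such that at most `n`
terms of `x` exceed `t`. -/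
noncomputable def decreasingRearrangement (x : ℕ → ℝ) (n : ℕ) : ℝ :=
  sInf {t : ℝ | 0 ≤ t ∧ {k | t < x k}.encard ≤ n}

lemma bddBelow_levels (x : ℕ → ℝ) (n : ℕ) :
    BddBelow {t : ℝ | 0 ≤ t ∧ {k | t < x k}.encard ≤ n} :=
  ⟨0, fun _ ht => ht.1⟩

lemma nonempty_levels {x : ℕ → ℝ} (hb : ∃ M, ∀ k, x k ≤ M) (n : ℕ) :
    {t : ℝ | 0 ≤ t ∧ {k | t < x k}.encard ≤ n}.Nonempty := by
  obtain ⟨M, hM⟩ := hb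
  refine ⟨max 0 M, le_max_left _ _, ?_⟩
  have h : {k | max 0 M < x k} = ∅ := by
    ext k
    simpa using fun _ => hM k
  rw [h, Set.encard_empty]
  exact zero_le

lemma decreasingRearrangement_nonneg (x : ℕ → ℝ) (n : ℕ) : 0 ≤ decreasingRearrangement x n :=
  Real.sInf_nonneg fun _ ht => ht.1

lemma antitone_decreasingRearrangement {x : ℕ → ℝ} (hb : ∃ M, ∀ k, x k ≤ M) :
    Antitone (decreasingRearrangement x) := fun m n hmn =>
  csInf_le_csInf (bddBelow_levels x n) (nonempty_levels hb m)
    fun _ ht => ⟨ht.1, ht.2.trans (by exact_mod_cast hmn)⟩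

lemma lt_decreasingRearrangement_iff {x : ℕ → ℝ} (hb : ∃ M, ∀ k, x k ≤ M) {t : ℝ} (ht : 0 ≤ t)
    (n : ℕ) : t < decreasingRearrangement x n ↔ (n : ℕ∞) < {k | t < x k}.encard := by
  constructor
  · intro h
    by_contra! hn
    exact absurd (csInf_le (bddBelow_levels x n) ⟨ht, hn⟩) (not_le.2 h)
  · intro h
    obtain ⟨T, hT, hcard⟩ := Set.exists_subset_encard_eq (Order.add_one_le_of_lt h)
    have hfin : T.Finite := Set.finite_of_encard_eq_coe (k := n + 1) (by simpa using hcard)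
    have hne : T.Nonempty := by
      rw [← Set.encard_pos, hcard]
      exact (Nat.cast_add_one_pos n)
    obtain ⟨m, hm, hmin⟩ := T.exists_min_image x hfin hne
    refine (show t < x m from hT hm).trans_le (le_csInf (nonempty_levels hb n) ?_)
    rintro s ⟨-, hs⟩
    by_contra! hsm
    have h1 : T.encard ≤ n := (Set.encard_le_encard fun k hk => hsm.trans_le (hmin k hk)).trans hs
    rw [hcard] at h1
    exact absurd (show n + 1 ≤ n by exact_mod_cast h1) (by omega)

lemma Antitone.sum_le_sum_range_card {w : ℕ → ℝ≥0∞} (hw : Antitone w) (s : Finset ℕ) :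
    ∑ k ∈ s, w k ≤ ∑ k ∈ Finset.range s.card, w k := by
  induction s using Finset.induction_on_max with
  | empty => simp
  | insert a s hs ih =>
    have ha : a ∉ s := fun h => (hs a h).false
    have hcard : s.card ≤ a := by
      simpa using Finset.card_le_card (t := Finset.range a) fun k hk => Finset.mem_range.2 (hs k hk)
    rw [Finset.sum_insert ha, Finset.card_insert_of_notMem ha, Finset.sum_range_succ, add_comm]
    exact add_le_add ih (hw hcard)

open MeasureTheory

lemma Antitone.withDensity_count_le {w : ℕ → ℝ≥0∞} (hw : Antitone w) (S : Set ℕ) :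
    Measure.count.withDensity w S ≤ Measure.count.withDensity w {n : ℕ | (n : ℕ∞) < S.encard} := by
  by_cases hS : S.Finite
  · lift S to Finset ℕ using hS
    have hr : {n : ℕ | (n : ℕ∞) < (S : Set ℕ).encard} = (Finset.range S.card : Finset ℕ) := by
      ext n
      simp
    have key (s : Finset ℕ) : Measure.count.withDensity w (s : Set ℕ) = ∑ k ∈ s, w k := by
      rw [withDensity_apply _ s.measurableSet, lintegral_finset]
      simp
    rw [hr, key, key]
    exact hw.sum_le_sum_range_card S
  · refine measure_mono fun n _ => ?_
    simp [Set.encard_eq_top hS]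

lemma tsum_rpow_eq_lintegral_count {x : ℕ → ℝ} (hx : ∀ k, 0 ≤ x k) {p : ℝ} (hp : 0 < p) :
    ∑' k, ENNReal.ofReal (x k) ^ p = ENNReal.ofReal p *
      ∫⁻ t in Set.Ioi 0, Measure.count {k | t < x k} * ENNReal.ofReal (t ^ (p - 1)) := by
  rw [← lintegral_rpow_eq_lintegral_meas_lt_mul _ (ae_of_all _ hx)
    (measurable_of_countable x).aemeasurable hp, lintegral_count]
  exact tsum_congr fun k => ENNReal.ofReal_rpow_of_nonneg (hx k) hp.le

lemma tsum_mul_eq_lintegral_withDensity (w : ℕ → ℝ≥0∞) {x : ℕ → ℝ} (hx : ∀ k, 0 ≤ x k) :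
    ∑' k, w k * ENNReal.ofReal (x k) =
      ∫⁻ t in Set.Ioi 0, Measure.count.withDensity w {k | t < x k} := by
  rw [← lintegral_eq_lintegral_meas_lt _ (ae_of_all _ hx) (measurable_of_countable x).aemeasurable,
    lintegral_withDensity_eq_lintegral_mul _ (measurable_of_countable w)
      (measurable_of_countable _), lintegral_count]
  rfl

lemma setOf_lt_decreasingRearrangement {x : ℕ → ℝ} (hb : ∃ M, ∀ k, x k ≤ M) {t : ℝ} (ht : 0 ≤ t) :
    {n | t < decreasingRearrangement x n} = {n : ℕ | (n : ℕ∞) < {k | t < x k}.encard} :=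
  Set.ext fun n => lt_decreasingRearrangement_iff hb ht n

lemma encard_setOf_natCast_lt (c : ℕ∞) : {n : ℕ | (n : ℕ∞) < c}.encard = c := by
  induction c using ENat.recTopCoe with
  | top => simp
  | coe c =>
    have h : {n : ℕ | (n : ℕ∞) < c} = (Finset.range c : Finset ℕ) := by
      ext n
      simp
    rw [h, Set.encard_coe_eq_coe_finsetCard, Finset.card_range]

lemma tsum_decreasingRearrangement_rpow {x : ℕ → ℝ} (hx : ∀ k, 0 ≤ x k)
    (hb : ∃ M, ∀ k, x k ≤ M) {p : ℝ} (hp : 0 < p) :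
    ∑' k, ENNReal.ofReal (decreasingRearrangement x k) ^ p = ∑' k, ENNReal.ofReal (x k) ^ p := by
  rw [tsum_rpow_eq_lintegral_count hx hp,
    tsum_rpow_eq_lintegral_count (decreasingRearrangement_nonneg x) hp]
  congr 1
  refine setLIntegral_congr_fun measurableSet_Ioi fun t ht => ?_
  simp only [setOf_lt_decreasingRearrangement hb (le_of_lt ht),
    Measure.count_apply (MeasurableSet.of_discrete), encard_setOf_natCast_lt]

lemma Antitone.tsum_mul_le_tsum_mul_decreasingRearrangement {w : ℕ → ℝ≥0∞} (hw : Antitone w)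
    {x : ℕ → ℝ} (hx : ∀ k, 0 ≤ x k) (hb : ∃ M, ∀ k, x k ≤ M) :
    ∑' k, w k * ENNReal.ofReal (x k) ≤
      ∑' k, w k * ENNReal.ofReal (decreasingRearrangement x k) := by
  rw [tsum_mul_eq_lintegral_withDensity w hx,
    tsum_mul_eq_lintegral_withDensity w (decreasingRearrangement_nonneg x)]
  refine setLIntegral_mono' measurableSet_Ioi fun t ht => ?_
  rw [setOf_lt_decreasingRearrangement hb (le_of_lt ht)]
  exact hw.withDensity_count_le _

lemma exists_bound_of_tsum_rpow_lt_top {x : ℕ → ℝ} {p : ℝ} (hp : 0 < p)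
    (hxp : (∑' k, ENNReal.ofReal (x k) ^ p) < ⊤) : ∃ M, ∀ k, x k ≤ M := by
  refine ⟨((∑' k, ENNReal.ofReal (x k) ^ p) ^ p⁻¹).toReal, fun k => ?_⟩
  refine (ENNReal.ofReal_le_iff_le_toReal
    (ENNReal.rpow_ne_top_of_nonneg (inv_nonneg.2 hp.le) hxp.ne)).1 ?_
  rw [ENNReal.le_rpow_inv_iff hp]
  exact ENNReal.le_tsum k

lemma antitone_hilbertMatrix (j : ℕ) : Antitone (hilbertMatrix j) := fun m n hmn => by
  unfold hilbertMatrix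
  gcongr

lemma mulVec_hilbertMatrix (x : ℕ → ℝ) (j : ℕ) :
    mulVec hilbertMatrix x j =
      ∑' k, ENNReal.ofReal (hilbertMatrix j k) * ENNReal.ofReal (x k) :=
  tsum_congr fun k => ENNReal.ofReal_mul (by unfold hilbertMatrix; positivity)

/-- The `ℓ_p`-norm of the Hilbert matrix is determined by decreasing sequences:
for every nonnegative `x ∈ ℓ_p` there is a nonnegative decreasing `y` with the same
`ℓ_p`-sum and `∑_j ((Hy)_j)^p ≥ ∑_j ((Hx)_j)^p`. -/
theorem lp_norm_determined_by_decreasing_hilbert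
    (p : ℝ) (hp : 1 ≤ p)
    (x : ℕ → ℝ) (hx : ∀ k, 0 ≤ x k)
    (hxp : (∑' k, ENNReal.ofReal (x k) ^ p) < ⊤) :
    ∃ y : ℕ → ℝ, (∀ k, 0 ≤ y k) ∧ Antitone y ∧
      (∑' k, ENNReal.ofReal (y k) ^ p) = (∑' k, ENNReal.ofReal (x k) ^ p) ∧
      (∑' j, (mulVec hilbertMatrix x j) ^ p) ≤
        (∑' j, (mulVec hilbertMatrix y j) ^ p) := by
  have hp0 : 0 < p := by linarith
  have hb := exists_bound_of_tsum_rpow_lt_top hp0 hxp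
  refine ⟨decreasingRearrangement x, decreasingRearrangement_nonneg x,
    antitone_decreasingRearrangement hb, tsum_decreasingRearrangement_rpow hx hb hp0,
    ENNReal.tsum_le_tsum fun j => ENNReal.rpow_le_rpow ?_ hp0.le⟩
  rw [mulVec_hilbertMatrix, mulVec_hilbertMatrix]
  exact Antitone.tsum_mul_le_tsum_mul_decreasingRearrangement
    (fun m n hmn => ENNReal.ofReal_le_ofReal (antitone_hilbertMatrix j hmn)) hx hb
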